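/- For every infinite binary sequence X, the constructive strong dimension of X equals the limsup as n tends to infinity of K(X restricted to n)/n. -/

import Mathlib

open Filter Topology

abbrev Cantor := ℕ → Bool

/-- The length-`n` prefix of an infinite binary sequence, as a list. -/
def pref (X : ℕ → Bool) (n : ℕ) : List Bool := (List.range n).map X

/-- An `s`-gale: a nonnegative function on strings satisfying the averaging
condition `2^s d(w) = d(w0) + d(w1)`. -/
def IsSGale (s : ℝ) (d : List Bool → ℝ) : Prop :=
  (∀ w, 0 ≤ d w) ∧ ∀ w, (2 : ℝ) ^ s * d w = d (w ++ [false]) + d (w ++ [true])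

/-- A real-valued function on strings is lower semicomputable (constructive):
it is the pointwise monotone limit of a computable rational approximation. -/
def LowerSemicomputable (d : List Bool → ℝ) : Prop :=
  ∃ g : List Bool → ℕ → ℚ, Computable₂ g ∧
    (∀ w, Monotone fun i => (g w i : ℝ)) ∧
    ∀ w, Filter.Tendsto (fun i => (g w i : ℝ)) Filter.atTop (nhds (d w))

/-- `d` succeeds on `X`: `limsup_n d(X↾n) = ∞`, i.e. `d` is unbounded on the
prefixes of `X`. -/
def SucceedsOn (d : List Bool → ℝ) (X : Cantor) : Prop :=
  ∀ C : ℝ, ∃ n, C < d (pref X n)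

/-- `d` strongly succeeds on `X`: `liminf_n d(X↾n) = ∞`. -/
def StronglySucceedsOn (d : List Bool → ℝ) (X : Cantor) : Prop :=
  ∀ C : ℝ, ∃ N, ∀ n ≥ N, C < d (pref X n)

/-- The constructive dimension of a class: the infimum of all `s ≥ 0` such that
some constructive (lower semicomputable) `s`-gale succeeds on every member. -/
noncomputable def cdim (A : Set Cantor) : ℝ :=
  sInf {s : ℝ | 0 ≤ s ∧ ∃ d : List Bool → ℝ,
    LowerSemicomputable d ∧ IsSGale s d ∧ ∀ X ∈ A, SucceedsOn d X}

/-- The constructive strong dimension of a class: the infimum of all `s ≥ 0`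
such that some constructive `s`-gale strongly succeeds on every member. -/
noncomputable def cDim (A : Set Cantor) : ℝ :=
  sInf {s : ℝ | 0 ≤ s ∧ ∃ d : List Bool → ℝ,
    LowerSemicomputable d ∧ IsSGale s d ∧ ∀ X ∈ A, StronglySucceedsOn d X}

/-- A prefix-free machine: a partial computable map from programs (finite
binary strings) to strings, whose domain is an antichain under the prefix
relation. -/
def PFMachine (M : List Bool →. List Bool) : Prop :=
  Partrec M ∧ ∀ p q : List Bool, (M p).Dom → (M q).Dom → p <+: q → p = q

/-- A universal prefix-free machine: a prefix-free machine simulating every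
prefix-free machine with only a constant overhead in program length. -/
def UniversalPF (U : List Bool →. List Bool) : Prop :=
  PFMachine U ∧ ∀ M : List Bool →. List Bool, PFMachine M → ∃ c : ℕ,
    ∀ w p : List Bool, w ∈ M p → ∃ q : List Bool, w ∈ U q ∧ q.length ≤ p.length + c

/-- Prefix-free Kolmogorov complexity with respect to the machine `U`: the
length of a shortest program producing `w`. -/
noncomputable def K (U : List Bool →. List Bool) (w : List Bool) : ℕ :=
  sInf {n : ℕ | ∃ p : List Bool, w ∈ U p ∧ p.length = n}

/-- `dimK U X = liminf_n K(X↾n)/n`, the (Kolmogorov characterization of the)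
constructive dimension of the sequence `X`. -/
noncomputable def dimK (U : List Bool →. List Bool) (X : Cantor) : ℝ :=
  Filter.liminf (fun n : ℕ => (K U (pref X n) : ℝ) / n) Filter.atTop

/-- `DimK U X = limsup_n K(X↾n)/n`, the (Kolmogorov characterization of the)
constructive strong dimension of the sequence `X`. -/
noncomputable def DimK (U : List Bool →. List Bool) (X : Cantor) : ℝ :=
  Filter.limsup (fun n : ℕ => (K U (pref X n) : ℝ) / n) Filter.atTop


/-! ### Computability on the rationals -/

/-- The underlying (non-surjective) encoding of the rationals. -/
def enc0 (q : ℚ) : ℕ := @Encodable.encode ℚ Rat.instEncodable q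

instance decEnc0 : DecidablePred fun n => n ∈ Set.range enc0 :=
  fun n => @Encodable.decidableRangeEncode ℚ Rat.instEncodable n

theorem encQ_eq (q : ℚ) : @Encodable.encode ℚ Rat.instDenumerable.toEncodable q =
    (List.range (enc0 q)).countP (· ∈ Set.range enc0) := by
  rfl

theorem enc0_eq (q : ℚ) : enc0 q = Nat.pair (Encodable.encode q.num) q.den := by
  rfl

theorem encI (a : ℕ) : Encodable.encode (a:ℤ) = 2*a := by
  rfl

theorem encIn (a : ℕ) : Encodable.encode (Int.negSucc a) = 2*a+1 := by
  rfl

def absI (x : ℕ) : ℕ := x / 2 + x % 2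

theorem absI_eq (z : ℤ) : absI (Encodable.encode z) = z.natAbs := by
  cases z with
  | ofNat a => 
    have := encI a
    simp only [Int.ofNat_eq_natCast]
    rw [this]; simp [absI]
  | negSucc a => rw [encIn]; simp [absI]; omega

def gcdB (a b : ℕ) : ℕ := Nat.findGreatest (fun k => a % k = 0 ∧ b % k = 0) (a + b)

theorem gcdB_eq (a b : ℕ) : gcdB a b = Nat.gcd a b := by
  unfold gcdB
  rw [Nat.findGreatest_eq_iff]
  refine ⟨?_, ?_, ?_⟩
  · rcases Nat.eq_zero_or_pos a with h | h
    · subst h; simp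
    · exact (Nat.gcd_le_left b h).trans (by omega)
  · intro _
    exact ⟨Nat.mod_eq_zero_of_dvd (Nat.gcd_dvd_left a b), Nat.mod_eq_zero_of_dvd (Nat.gcd_dvd_right a b)⟩
  · intro n hn hn2 ⟨h1, h2⟩
    have := Nat.dvd_gcd (Nat.dvd_of_mod_eq_zero h1) (Nat.dvd_of_mod_eq_zero h2)
    rcases Nat.eq_zero_or_pos (Nat.gcd a b) with h | h
    · rw [Nat.gcd_eq_zero_iff] at h; omega
    · exact absurd (Nat.le_of_dvd h this) (by omega)

theorem primrec_gcdB : Primrec₂ gcdB := by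
  unfold gcdB
  refine Primrec.nat_findGreatest (f := fun x : ℕ × ℕ => x.1 + x.2)
    (p := fun (x : ℕ × ℕ) k => x.1 % k = 0 ∧ x.2 % k = 0) (Primrec.nat_add.comp Primrec.fst Primrec.snd) ?_
  refine PrimrecPred.and ?_ ?_
  · exact Primrec.eq.comp (Primrec.nat_mod.comp (Primrec.fst.comp Primrec.fst) Primrec.snd) (Primrec.const 0)
  · exact Primrec.eq.comp (Primrec.nat_mod.comp (Primrec.snd.comp Primrec.fst) Primrec.snd) (Primrec.const 0)

theorem primrec_gcd : Primrec₂ Nat.gcd := primrec_gcdB.of_eq gcdB_eq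

theorem mem_range_enc0 (n : ℕ) : n ∈ Set.range enc0 ↔
    (0 < n.unpair.2 ∧ Nat.gcd (absI n.unpair.1) n.unpair.2 = 1) := by
  constructor
  · rintro ⟨q, rfl⟩
    rw [enc0_eq, Nat.unpair_pair]
    refine ⟨q.den_pos, ?_⟩
    rw [absI_eq]
    exact q.reduced
  · rintro ⟨h1, h2⟩
    refine ⟨⟨Denumerable.ofNat ℤ n.unpair.1, n.unpair.2, h1.ne', ?_⟩, ?_⟩
    · rw [← absI_eq, Denumerable.encode_ofNat]; exact h2
    · rw [enc0_eq]
      simp only [Denumerable.encode_ofNat, Nat.pair_unpair]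

theorem primrec_mem_enc0 : PrimrecPred fun n : ℕ => n ∈ Set.range enc0 := by
  refine PrimrecPred.of_eq ?_ (fun n => (mem_range_enc0 n).symm)
  have h1 : Primrec fun n : ℕ => n.unpair.1 := Primrec.fst.comp Primrec.unpair
  have h2 : Primrec fun n : ℕ => n.unpair.2 := Primrec.snd.comp Primrec.unpair
  have h3 : Primrec absI := by
    unfold absI
    exact Primrec.nat_add.comp (Primrec.nat_div.comp Primrec.id (Primrec.const 2))
      (Primrec.nat_mod.comp Primrec.id (Primrec.const 2))
  exact PrimrecPred.and (Primrec.nat_lt.comp (Primrec.const 0) h2)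
    (Primrec.eq.comp (primrec_gcd.comp (h3.comp h1) h2) (Primrec.const 1))

def cntQ (n : ℕ) : ℕ := (List.range n).countP (· ∈ Set.range enc0)

theorem primrec_cntQ : Primrec cntQ := by
  have : Primrec (Nat.rec (motive := fun _ => ℕ) 0
      (fun n c => c + if n ∈ Set.range enc0 then 1 else 0) : ℕ → ℕ) := by
    refine Primrec.nat_rec₁ 0 ?_
    refine Primrec.nat_add.comp Primrec.snd ?_
    exact Primrec.ite (primrec_mem_enc0.comp Primrec.fst) (Primrec.const 1) (Primrec.const 0)
  refine this.of_eq fun n => ?_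
  induction n with
  | zero => rfl
  | succ n ih =>
    simp only [cntQ] at ih ⊢
    rw [List.range_succ, List.countP_append, ← ih]
    simp only [List.countP_singleton, decide_eq_true_eq]

theorem cntQ_enc0 (q : ℚ) :
    @Encodable.encode ℚ Rat.instDenumerable.toEncodable q = cntQ (enc0 q) := encQ_eq q

/-- Forming the nonnegative rational `a / (b + 1)` is computable. -/
theorem computable_mkQ : Computable₂ fun a b : ℕ => ((a : ℚ) / ((b : ℚ) + 1)) := by
  refine Primrec.to_comp ?_
  refine Primrec.encode_iff.1 ?_
  have h : Primrec fun x : ℕ × ℕ =>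
      cntQ (Nat.pair (2 * (x.1 / Nat.gcd x.1 (x.2+1))) ((x.2+1) / Nat.gcd x.1 (x.2+1))) := by
    have hs : Primrec fun x : ℕ × ℕ => x.2 + 1 := Primrec.succ.comp Primrec.snd
    have hg : Primrec fun x : ℕ × ℕ => Nat.gcd x.1 (x.2+1) := primrec_gcd.comp Primrec.fst hs
    refine primrec_cntQ.comp (Primrec₂.natPair.comp ?_ ?_)
    · exact Primrec.nat_mul.comp (Primrec.const 2) (Primrec.nat_div.comp Primrec.fst hg)
    · exact Primrec.nat_div.comp hs hg
  refine h.of_eq ?_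
  rintro ⟨a, b⟩
  refine Eq.trans ?_ (cntQ_enc0 _).symm
  have hq : ((a : ℚ) / ((b : ℚ) + 1)) = Rat.divInt (a:ℤ) ((b+1 : ℕ) : ℤ) := by
    rw [Rat.divInt_eq_div]; push_cast; rfl
  have e1 : ((a : ℚ) / ((b : ℚ) + 1)).num = ((a / Nat.gcd a (b+1) : ℕ) : ℤ) := by
    rw [hq, Rat.num_divInt]
    rw [Int.sign_eq_one_of_pos (by positivity), one_mul, Int.gcd_natCast_natCast, Nat.gcd_comm]
    push_cast; rfl
  have e2 : ((a : ℚ) / ((b : ℚ) + 1)).den = (b+1) / Nat.gcd a (b+1) := by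
    rw [hq, Rat.den_divInt]
    rw [if_neg (by positivity), Int.gcd_natCast_natCast, Nat.gcd_comm, Int.natAbs_natCast]
  dsimp only
  rw [enc0_eq, e1, e2, encI]

theorem enc0_lt_cntQ {m n : ℕ} (hm : m ∈ Set.range enc0) (h : m < n) : cntQ m < cntQ n := by
  have h1 : cntQ (m+1) = cntQ m + 1 := by
    simp only [cntQ]
    rw [List.range_succ, List.countP_append]
    simp only [List.countP_singleton, hm, decide_true, if_true]
  have h2 : cntQ (m+1) ≤ cntQ n := by
    exact List.Sublist.countP_le (List.range_sublist.2 h)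
  omega

theorem computable_enc0 : Computable enc0 := by
  have hp : Computable₂ fun (q : ℚ) (n : ℕ) => decide (n ∈ Set.range enc0 ∧
      cntQ n = @Encodable.encode ℚ Rat.instDenumerable.toEncodable q) := by
    refine Primrec.to_comp ?_
    have : PrimrecPred fun x : ℚ × ℕ => (x.2 ∈ Set.range enc0 ∧ cntQ x.2 = 
      @Encodable.encode ℚ Rat.instDenumerable.toEncodable x.1) := by
      refine PrimrecPred.and (primrec_mem_enc0.comp Primrec.snd) ?_
      exact Primrec.eq.comp (primrec_cntQ.comp Primrec.snd) (Primrec.encode.comp Primrec.fst)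
    exact primrecPred_iff_primrec_decide.1 this
  have := Partrec.rfind (p := fun (q : ℚ) (n : ℕ) => Part.some (decide (n ∈ Set.range enc0 ∧
      cntQ n = @Encodable.encode ℚ Rat.instDenumerable.toEncodable q))) hp
  refine this.of_eq_tot fun q => ?_
  refine Nat.mem_rfind.2 ⟨?_, ?_⟩
  · simp only [Part.mem_some_iff, cntQ_enc0]
    simp
  · intro m hm
    simp only [Part.mem_some_iff, cntQ_enc0]
    symm
    rw [decide_eq_false_iff_not]
    rintro ⟨h1, h2⟩
    exact absurd h2 (enc0_lt_cntQ h1 hm).ne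

theorem computable_one_lt : Computable fun q : ℚ => decide (1 < q) := by
  have h : Computable fun n : ℕ => decide (n.unpair.1 % 2 = 0 ∧ n.unpair.2 < n.unpair.1 / 2) := by
    refine Primrec.to_comp ?_
    have h1 : Primrec fun n : ℕ => n.unpair.1 := Primrec.fst.comp Primrec.unpair
    have h2 : Primrec fun n : ℕ => n.unpair.2 := Primrec.snd.comp Primrec.unpair
    refine primrecPred_iff_primrec_decide.1 (PrimrecPred.and ?_ ?_)
    · exact Primrec.eq.comp (Primrec.nat_mod.comp h1 (Primrec.const 2)) (Primrec.const 0)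
    · exact Primrec.nat_lt.comp h2 (Primrec.nat_div.comp h1 (Primrec.const 2))
  refine (h.comp computable_enc0).of_eq fun q => ?_
  rw [enc0_eq, Nat.unpair_pair]
  congr 1
  have hq : 1 < q ↔ (q.den : ℤ) < q.num := by
    rw [Rat.lt_iff]; simp
  rw [hq]
  cases h : q.num with
  | ofNat a =>
    simp only [Int.ofNat_eq_natCast]
    rw [encI]
    simp
  | negSucc a =>
    rw [encIn]
    simp only [eq_iff_iff]
    constructor
    · omega
    · intro h; have := Int.negSucc_lt_zero a; omega

/-! ### Strings -/

/-- All strings of length `n`. -/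
def allStr : ℕ → Finset (List Bool)
  | 0 => {[]}
  | n + 1 => (allStr n).image (fun w => w ++ [false]) ∪ (allStr n).image (fun w => w ++ [true])

theorem mem_allStr (n : ℕ) (w : List Bool) : w ∈ allStr n ↔ w.length = n := by
  induction n generalizing w with
  | zero => simp [allStr]
  | succ n ih =>
    simp only [allStr, Finset.mem_union, Finset.mem_image, ih]
    constructor
    · rintro (⟨v, h, rfl⟩ | ⟨v, h, rfl⟩) <;> simp [h]
    · intro h
      rcases List.eq_nil_or_concat w with rfl | ⟨v, b, rfl⟩
      · simp at h
      · simp at h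
        cases b
        · left; exact ⟨v, h, by simp⟩
        · right; exact ⟨v, h, by simp⟩

theorem sum_allStr_succ (d : List Bool → ℝ) (n : ℕ) :
    ∑ w ∈ allStr (n+1), d w = ∑ w ∈ allStr n, (d (w ++ [false]) + d (w ++ [true])) := by
  simp only [allStr]
  rw [Finset.sum_union, Finset.sum_image, Finset.sum_image, Finset.sum_add_distrib]
  · intro a _ b _ h; simpa using h
  · intro a _ b _ h; simpa using h
  · rw [Finset.disjoint_left]
    intro x hx hy
    simp only [Finset.mem_image] at hx hy
    obtain ⟨a, _, rfl⟩ := hx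
    obtain ⟨b, _, h⟩ := hy
    have := List.append_inj_right' h rfl
    simp at this

theorem card_allStr (n : ℕ) : (allStr n).card = 2 ^ n := by
  have : ∑ w ∈ allStr n, (1:ℝ) = 2 ^ n := by
    induction n with
    | zero => simp [allStr]
    | succ n ih =>
      rw [sum_allStr_succ (fun _ => 1)]
      rw [pow_succ, ← ih, Finset.sum_mul]
      norm_num
  simp at this
  exact_mod_cast this

theorem gale_sum {s : ℝ} {d : List Bool → ℝ} (hd : IsSGale s d) (n : ℕ) :
    ∑ w ∈ allStr n, d w = (2:ℝ) ^ (s * n) * d [] := by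
  induction n with
  | zero => simp [allStr]
  | succ n ih =>
    rw [sum_allStr_succ]
    simp_rw [← hd.2]
    rw [← Finset.mul_sum, ih, ← mul_assoc, ← Real.rpow_add (by norm_num)]
    push_cast
    ring_nf

/-- Strings of length in `[m q, m q + m)` with value above `1` are few. -/
theorem card_bucket {s : ℝ} (hs : 0 ≤ s) {d : List Bool → ℝ} (hd : IsSGale s d) (m q : ℕ) (hm : 0 < m)
    (S : Finset (List Bool)) (hS : ∀ w ∈ S, w.length / m = q ∧ 1 < d w) :
    (S.card : ℝ) ≤ m * ((2:ℝ) ^ (s * (m * (q+1))) * d []) := by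
  classical
  have hsub : S ⊆ (Finset.Ico (m*q) (m*q+m)).biUnion (fun n => S.filter (fun w => w.length = n)) := by
    intro w hw
    simp only [Finset.mem_biUnion, Finset.mem_Ico, Finset.mem_filter]
    refine ⟨w.length, ?_, hw, rfl⟩
    obtain ⟨h, -⟩ := hS w hw
    rw [← h]
    have h1 := Nat.div_add_mod w.length m
    have h2 := Nat.mod_lt w.length hm
    omega
  have h1 : (S.card : ℝ) ≤ ∑ n ∈ Finset.Ico (m*q) (m*q+m), ((S.filter (fun w => w.length = n)).card : ℝ) := by
    exact_mod_cast (Finset.card_le_card hsub).trans Finset.card_biUnion_le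
  refine h1.trans ?_
  have h2 : ∀ n ∈ Finset.Ico (m*q) (m*q+m), ((S.filter (fun w => w.length = n)).card : ℝ) ≤
      (2:ℝ) ^ (s * (m * (q+1))) * d [] := by
    intro n hn
    rw [Finset.mem_Ico] at hn
    calc ((S.filter (fun w => w.length = n)).card : ℝ)
        = ∑ w ∈ S.filter (fun w => w.length = n), (1:ℝ) := by simp
      _ ≤ ∑ w ∈ S.filter (fun w => w.length = n), d w := by
          refine Finset.sum_le_sum fun w hw => ?_
          exact (hS w (Finset.mem_filter.1 hw).1).2.le
      _ ≤ ∑ w ∈ allStr n, d w := by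
          refine Finset.sum_le_sum_of_subset_of_nonneg ?_ (fun w _ _ => hd.1 w)
          intro w hw
          exact (mem_allStr n w).2 (Finset.mem_filter.1 hw).2
      _ = (2:ℝ) ^ (s * n) * d [] := gale_sum hd n
      _ ≤ (2:ℝ) ^ (s * (m * (q+1))) * d [] := by
          refine mul_le_mul_of_nonneg_right ?_ (hd.1 [])
          refine Real.rpow_le_rpow_of_exponent_le (by norm_num) ?_
          refine mul_le_mul_of_nonneg_left ?_ hs
          have : n ≤ m * (q+1) := by rw [mul_add, mul_one]; omega
          exact_mod_cast this
  refine (Finset.sum_le_sum h2).trans ?_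
  simp

/-- Kraft's inequality for finite prefix-free sets. -/
theorem kraft_finite (S : Finset (List Bool))
    (hS : ∀ p ∈ S, ∀ q ∈ S, p <+: q → p = q) (N : ℕ) (hN : ∀ p ∈ S, p.length ≤ N) :
    ∑ p ∈ S, 2 ^ (N - p.length) ≤ 2 ^ N := by
  classical
  have hdis : (S : Set (List Bool)).PairwiseDisjoint
      (fun p => (allStr (N - p.length)).image (fun v => p ++ v)) := by
    intro p hp q hq hpq
    rw [Function.onFun, Finset.disjoint_left]
    intro x hx hy
    simp only [Finset.mem_image] at hx hy
    obtain ⟨a, _, ha⟩ := hx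
    obtain ⟨b, _, hb⟩ := hy
    have h1 : p <+: x := ⟨a, ha⟩
    have h2 : q <+: x := ⟨b, hb⟩
    rcases List.prefix_or_prefix_of_prefix h1 h2 with h | h
    · exact hpq (hS p hp q hq h)
    · exact hpq (hS q hq p hp h).symm
  have hcard : (S.biUnion (fun p => (allStr (N - p.length)).image (fun v => p ++ v))).card
      = ∑ p ∈ S, 2 ^ (N - p.length) := by
    rw [Finset.card_biUnion hdis]
    refine Finset.sum_congr rfl fun p _ => ?_
    rw [Finset.card_image_of_injective _ (List.append_right_injective p), card_allStr]
  rw [← hcard, ← card_allStr N]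
  refine Finset.card_le_card ?_
  intro x hx
  simp only [Finset.mem_biUnion, Finset.mem_image, mem_allStr] at hx
  obtain ⟨p, hp, v, hv, rfl⟩ := hx
  rw [mem_allStr, List.length_append, hv]
  have := hN p hp
  omega

/-! ### Machines from enumerations -/

theorem machine_of_enum (out : ℕ → Option (List Bool × List Bool)) (hc : Computable out)
    (hpf : ∀ k k' y y', out k = some y → out k' = some y' → y.1 <+: y'.1 → y.1 = y'.1) :
    ∃ M : List Bool →. List Bool, PFMachine M ∧ ∀ k y, out k = some y →
      (∀ k' y', out k' = some y' → y'.1 = y.1 → y'.2 = y.2) → y.2 ∈ M y.1 := by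
  let f : List Bool → ℕ → Option (List Bool) := fun p k =>
    (out k).bind fun y => if y.1 = p then some y.2 else none
  have hf : Computable₂ f := by
    refine Computable.option_bind (hc.comp Computable.snd) ?_
    refine Primrec.to_comp ?_
    refine Primrec.ite (Primrec.eq.comp (Primrec.fst.comp Primrec.snd) (Primrec.fst.comp Primrec.fst))
      (Primrec.option_some.comp (Primrec.snd.comp Primrec.snd)) (Primrec.const none)
  have hmem : ∀ p k v, v ∈ f p k ↔ out k = some (p, v) := by
    intro p k v
    simp only [f, Option.mem_def, Option.bind_eq_some_iff]
    constructor
    · rintro ⟨⟨y1, y2⟩, h1, h2⟩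
      split_ifs at h2 with h
      simp only [Option.some.injEq] at h2
      subst h2; subst h; exact h1
    · intro h
      exact ⟨_, h, by simp⟩
  refine ⟨fun p => Nat.rfindOpt (f p), ⟨Partrec.rfindOpt hf, ?_⟩, ?_⟩
  · intro p q hp hq hpq
    obtain ⟨k, v, h⟩ := Nat.rfindOpt_dom.1 hp
    obtain ⟨k', v', h'⟩ := Nat.rfindOpt_dom.1 hq
    exact hpf k k' _ _ ((hmem _ _ _).1 h) ((hmem _ _ _).1 h') hpq
  · rintro k ⟨p, v⟩ hk huniq
    have hdom : (Nat.rfindOpt (f p)).Dom := Nat.rfindOpt_dom.2 ⟨k, v, (hmem _ _ _).2 hk⟩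
    obtain ⟨v', hv'⟩ := Part.dom_iff_mem.1 hdom
    obtain ⟨k', h'⟩ := Nat.rfindOpt_spec hv'
    have := huniq k' _ ((hmem _ _ _).1 h') rfl
    simp only at this
    subst this
    exact hv'

theorem computable_dec2 : Computable (Encodable.decode₂ (List Bool × ℕ)) := by
  refine Primrec.to_comp ?_
  refine Primrec.option_bind Primrec.decode ?_
  exact Primrec.option_guard (p := fun (x : ℕ × (List Bool × ℕ)) y => Encodable.encode y = x.1)
    (Primrec.eq.comp (Primrec.encode.comp Primrec.snd) (Primrec.fst.comp Primrec.fst)) Primrec.snd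

section Enum

variable (h : List Bool → ℕ → Bool) (m a : ℕ)

/-- First stage at which `h w` turns true. -/
def firstHit (w : List Bool) (i : ℕ) : Bool := h w i && (decide (i = 0) || !(h w (i-1)))

def bucketHit (q k : ℕ) : Bool :=
  ((Encodable.decode₂ (List Bool × ℕ) k).map
    fun y => decide (y.1.length / m = q) && firstHit h y.1 y.2).getD false

def hitCount (q k : ℕ) : ℕ :=
  Nat.rec (motive := fun _ => ℕ) 0 (fun k' c => c + bif bucketHit h m q k' then 1 else 0) k

def progBits (L c : ℕ) : List Bool := (List.range L).map fun j => decide (c / 2 ^ j % 2 = 1)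

def mkProg (q c : ℕ) : List Bool := (List.range q).map (fun _ => true) ++ false :: progBits (a * q) c

def outEnum (k : ℕ) : Option (List Bool × List Bool) :=
  (Encodable.decode₂ (List Bool × ℕ) k).bind fun y =>
    bif firstHit h y.1 y.2 then
      some (mkProg a (y.1.length / m) (hitCount h m (y.1.length / m) k), y.1) else none

variable {h}

theorem primrec_pow : Primrec₂ (fun x y : ℕ => x ^ y) := Primrec₂.unpaired'.1 Nat.Primrec.pow

theorem primrec_progBits : Primrec₂ progBits := by
  refine Primrec.list_map (Primrec.list_range.comp Primrec.fst) ?_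
  refine primrecPred_iff_primrec_decide.1 ?_
  refine Primrec.eq.comp ?_ (Primrec.const 1)
  refine Primrec.nat_mod.comp ?_ (Primrec.const 2)
  exact Primrec.nat_div.comp (Primrec.snd.comp Primrec.fst) (primrec_pow.comp (Primrec.const 2) Primrec.snd)

theorem primrec_mkProg : Primrec₂ (mkProg a) := by
  refine Primrec.list_append.comp ?_ (Primrec.list_cons.comp (Primrec.const false) ?_)
  · exact Primrec.list_map (Primrec.list_range.comp Primrec.fst) (Primrec.const true)
  · exact primrec_progBits.comp (Primrec.nat_mul.comp (Primrec.const a) Primrec.fst) Primrec.snd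

theorem computable_firstHit (hh : Computable₂ h) : Computable₂ (firstHit h) := by
  refine Primrec.and.to_comp.comp hh (Primrec.or.to_comp.comp ?_ (Primrec.not.to_comp.comp ?_))
  · exact (primrecPred_iff_primrec_decide.1 (Primrec.eq.comp Primrec.snd (Primrec.const 0))).to_comp
  · exact hh.comp Computable.fst (Primrec.nat_sub.to_comp.comp Computable.snd (Computable.const 1))

theorem computable_bucketHit (hh : Computable₂ h) : Computable₂ (bucketHit h m) := by
  refine Computable.option_getD (Computable.option_map (computable_dec2.comp Computable.snd) ?_)
    (Computable.const false)
  refine Primrec.and.to_comp.comp ?_ ?_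
  · refine (primrecPred_iff_primrec_decide.1 (Primrec.eq.comp ?_ ?_)).to_comp
    · exact Primrec.nat_div.comp (Primrec.list_length.comp (Primrec.fst.comp Primrec.snd)) (Primrec.const m)
    · exact Primrec.fst.comp Primrec.fst
  · exact (computable_firstHit hh).comp (Computable.fst.comp Computable.snd)
      (Computable.snd.comp Computable.snd)

theorem computable_hitCount (hh : Computable₂ h) : Computable₂ (hitCount h m) := by
  refine Computable.nat_rec (f := fun x : ℕ × ℕ => x.2) (g := fun _ => 0)
    (h := fun x (y : ℕ × ℕ) => y.2 + bif bucketHit h m x.1 y.1 then 1 else 0)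
    Computable.snd (Computable.const 0) ?_
  refine Primrec.nat_add.to_comp.comp (Computable.snd.comp Computable.snd) ?_
  refine Computable.cond ?_ (Computable.const 1) (Computable.const 0)
  exact (computable_bucketHit m hh).comp (Computable.fst.comp Computable.fst)
    (Computable.fst.comp Computable.snd)

theorem computable_outEnum (hh : Computable₂ h) : Computable (outEnum h m a) := by
  refine Computable.option_bind computable_dec2 ?_
  have hl : Computable fun x : ℕ × (List Bool × ℕ) => x.2.1.length / m :=
    (Primrec.nat_div.comp (Primrec.list_length.comp (Primrec.fst.comp Primrec.snd)) (Primrec.const m)).to_comp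
  refine Computable.cond ?_ (Computable.option_some.comp (Computable.pair ?_ ?_)) (Computable.const none)
  · exact (computable_firstHit hh).comp (Computable.fst.comp Computable.snd)
      (Computable.snd.comp Computable.snd)
  · exact (primrec_mkProg a).to_comp.comp hl ((computable_hitCount m hh).comp hl Computable.fst)
  · exact Computable.fst.comp Computable.snd

theorem mkProg_length (q c : ℕ) : (mkProg a q c).length = q + 1 + a * q := by
  simp [mkProg, progBits]; ring

theorem mkProg_pre {q q' : ℕ} {x y : List Bool}
    (hp : (List.range q).map (fun _ => true) ++ false :: x <+: (List.range q').map (fun _ => true) ++ false :: y) :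
    q = q' ∧ x <+: y := by
  have e : ∀ n, (List.range n).map (fun _ => true) = List.replicate n true := by
    intro n; simp [List.map_const']
  rw [e, e] at hp
  induction q generalizing q' with
  | zero =>
    cases q' with
    | zero => simpa using hp
    | succ n => simp [List.replicate_succ] at hp
  | succ q ih =>
    cases q' with
    | zero => simp [List.replicate_succ] at hp
    | succ n =>
      simp only [List.replicate_succ, List.cons_append, List.cons_prefix_cons, true_and] at hp
      have := ih hp
      exact ⟨by omega, this.2⟩

theorem mkProg_prefix {q q' c c' : ℕ} (hp : mkProg a q c <+: mkProg a q' c') :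
    q = q' ∧ mkProg a q c = mkProg a q' c' := by
  have h1 := (mkProg_pre hp).1
  subst h1
  exact ⟨rfl, hp.eq_of_length (by rw [mkProg_length, mkProg_length])⟩

theorem progBits_inj {L c c' : ℕ} (h1 : c < 2 ^ L) (h2 : c' < 2 ^ L)
    (he : progBits L c = progBits L c') : c = c' := by
  refine Nat.eq_of_testBit_eq fun j => ?_
  by_cases hj : j < L
  · have := List.map_inj_left.1 he j (List.mem_range.2 hj)
    rw [Nat.testBit_eq_decide_div_mod_eq, Nat.testBit_eq_decide_div_mod_eq]
    exact this
  · have hle : 2 ^ L ≤ 2 ^ j := Nat.pow_le_pow_right (by norm_num) (by omega)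
    rw [Nat.testBit_lt_two_pow (h1.trans_le hle), Nat.testBit_lt_two_pow (h2.trans_le hle)]

theorem mkProg_inj {q q' c c' : ℕ} (h1 : c < 2 ^ (a*q)) (h2 : c' < 2 ^ (a*q'))
    (he : mkProg a q c = mkProg a q' c') : q = q' ∧ c = c' := by
  have hq := (mkProg_prefix a (he ▸ List.prefix_rfl : mkProg a q c <+: mkProg a q' c')).1
  subst hq
  refine ⟨rfl, progBits_inj h1 h2 ?_⟩
  simpa [mkProg] using he

theorem hitCount_eq (q k : ℕ) : hitCount h m q k = ((Finset.range k).filter (fun j => bucketHit h m q j = true)).card := by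
  induction k with
  | zero => rfl
  | succ k ih =>
    have : hitCount h m q (k+1) = hitCount h m q k + bif bucketHit h m q k then 1 else 0 := rfl
    rw [this, ih, Finset.range_add_one, Finset.filter_insert]
    cases hb : bucketHit h m q k
    · simp
    · simp

theorem hitCount_lt {q k k' : ℕ} (hk : bucketHit h m q k = true) (hlt : k < k') :
    hitCount h m q k < hitCount h m q k' := by
  rw [hitCount_eq, hitCount_eq]
  refine Finset.card_lt_card ?_
  rw [Finset.ssubset_iff_of_subset]
  · exact ⟨k, by simp [hk, hlt], by simp⟩
  · intro x; simp only [Finset.mem_filter, Finset.mem_range]; intro hx; exact ⟨by omega, hx.2⟩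

theorem bucketHit_iff (q k : ℕ) : bucketHit h m q k = true ↔
    ∃ w i, (Encodable.decode₂ (List Bool × ℕ) k) = some (w, i) ∧ w.length / m = q ∧ firstHit h w i = true := by
  unfold bucketHit
  cases hd : (Encodable.decode₂ (List Bool × ℕ) k) with
  | none => simp
  | some y => obtain ⟨w, i⟩ := y; simp

theorem firstHit_unique (hmono : ∀ w, ∀ i j, i ≤ j → h w i = true → h w j = true) {w : List Bool} {i j : ℕ}
    (hi : firstHit h w i = true) (hj : firstHit h w j = true) : i = j := by
  have key : ∀ i j, firstHit h w i = true → firstHit h w j = true → ¬ i < j := by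
    intro i j hi hj hlt
    simp only [firstHit, Bool.and_eq_true, Bool.or_eq_true, decide_eq_true_eq, Bool.not_eq_true'] at hi hj
    rcases hj.2 with h0 | h0
    · omega
    · have := hmono w i (j-1) (by omega) hi.1
      rw [this] at h0; simp at h0
  have := key i j hi hj
  have := key j i hj hi
  omega

/-- The count of hits is bounded by the size of a bucket. -/
theorem hitCount_le (hmono : ∀ w, ∀ i j, i ≤ j → h w i = true → h w j = true)
    {q k B : ℕ} (hB : ∀ S : Finset (List Bool), (∀ w ∈ S, w.length / m = q ∧ ∃ i, h w i = true) → S.card ≤ B) :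
    hitCount h m q k ≤ B := by
  classical
  rw [hitCount_eq]
  let f : ℕ → List Bool := fun k => ((Encodable.decode₂ (List Bool × ℕ) k).getD ([], 0)).1
  have hinj : Set.InjOn f ((Finset.range k).filter (fun j => bucketHit h m q j = true)) := by
    intro x hx y hy hxy
    simp only [Finset.coe_filter, Set.mem_ofPred_eq] at hx hy
    obtain ⟨w, i, h1, h2, h3⟩ := (bucketHit_iff _ _ _).1 hx.2
    obtain ⟨w', i', h1', h2', h3'⟩ := (bucketHit_iff _ _ _).1 hy.2
    simp only [f, h1, h1', Option.getD_some] at hxy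
    subst hxy
    have := firstHit_unique hmono h3 h3'
    subst this
    exact (Encodable.decode₂_eq_some.1 h1).symm.trans (Encodable.decode₂_eq_some.1 h1')
  rw [← Finset.card_image_of_injOn hinj]
  refine hB _ fun w hw => ?_
  simp only [Finset.mem_image, Finset.mem_filter] at hw
  obtain ⟨j, ⟨_, hj⟩, rfl⟩ := hw
  obtain ⟨w, i, h1, h2, h3⟩ := (bucketHit_iff _ _ _).1 hj
  simp only [f, h1, Option.getD_some]
  refine ⟨h2, i, ?_⟩
  simp only [firstHit, Bool.and_eq_true] at h3
  exact h3.1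

end Enum

theorem outEnum_eq_some {h : List Bool → ℕ → Bool} {m a k : ℕ} {y : List Bool × List Bool}
    (hy : outEnum h m a k = some y) :
    y.1 = mkProg a (y.2.length / m) (hitCount h m (y.2.length / m) k) ∧
      bucketHit h m (y.2.length / m) k = true ∧ ∃ i, Encodable.decode₂ (List Bool × ℕ) k = some (y.2, i) := by
  simp only [outEnum, Option.bind_eq_some_iff] at hy
  obtain ⟨⟨w, i⟩, h1, h2⟩ := hy
  cases hf : firstHit h w i with
  | false => simp [hf] at h2
  | true =>
    simp only [hf, cond_true, Option.some.injEq] at h2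
    subst h2
    exact ⟨rfl, (bucketHit_iff _ _ _).2 ⟨w, i, h1, rfl, hf⟩, i, h1⟩

theorem lemB0 {U : List Bool →. List Bool} (hU : UniversalPF U) {h : List Bool → ℕ → Bool} (hh : Computable₂ h)
    (hmono : ∀ w, ∀ i j, i ≤ j → h w i = true → h w j = true) (m a q0 : ℕ)
    (hB : ∀ q, q0 ≤ q → ∀ S : Finset (List Bool),
      (∀ w ∈ S, w.length / m = q ∧ ∃ i, h w i = true) → S.card < 2 ^ (a * q)) :
    ∃ c : ℕ, ∀ w : List Bool, q0 ≤ w.length / m → (∃ i, h w i = true) →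
      ∃ p, w ∈ U p ∧ p.length ≤ w.length / m + 1 + a * (w.length / m) + c := by
  have hcnt : ∀ q k, q0 ≤ q → hitCount h m q k < 2 ^ (a * q) := by
    intro q k hq
    have := hitCount_le m hmono (q := q) (k := k) (B := 2 ^ (a*q) - 1)
      (fun S hS => by have := hB q hq S hS; omega)
    have := Nat.pow_pos (n := a * q) (show 0 < 2 by norm_num)
    omega
  obtain ⟨M, hM, hMo⟩ := machine_of_enum (outEnum h m a) (computable_outEnum m a hh) (by
    intro k k' y y' hy hy' hp
    rw [(outEnum_eq_some hy).1, (outEnum_eq_some hy').1] at hp ⊢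
    exact (mkProg_prefix a hp).2)
  obtain ⟨c, hc⟩ := hU.2 M hM
  refine ⟨c, fun w hw hi => ?_⟩
  have hfirst : ∃ i, firstHit h w i = true := by
    classical
    refine ⟨Nat.find hi, ?_⟩
    simp only [firstHit, Bool.and_eq_true, Bool.or_eq_true, decide_eq_true_eq, Bool.not_eq_true']
    refine ⟨Nat.find_spec hi, ?_⟩
    by_cases h0 : Nat.find hi = 0
    · exact Or.inl h0
    · right
      have := Nat.find_min hi (m := Nat.find hi - 1) (by omega)
      simpa using this
  obtain ⟨i, hi'⟩ := hfirst
  have hdec : Encodable.decode₂ (List Bool × ℕ) (Encodable.encode (w, i)) = some (w, i) := Encodable.encodek₂ _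
  set k := Encodable.encode (w, i) with hk
  have hout : outEnum h m a k = some (mkProg a (w.length / m) (hitCount h m (w.length / m) k), w) := by
    simp [outEnum, hdec, hi']
  have hmem := hMo k _ hout (by
    intro k' y' hy' he
    obtain ⟨e1, e2, i', e3⟩ := outEnum_eq_some hy'
    rw [e1] at he
    simp only at he ⊢
    obtain ⟨hq, -⟩ := mkProg_prefix a (he ▸ List.prefix_rfl : mkProg a (y'.2.length / m) (hitCount h m (y'.2.length / m) k') <+: mkProg a (w.length / m) (hitCount h m (w.length / m) k))
    rw [hq] at he e2
    have hkk := (mkProg_inj a (hcnt _ _ hw) (hcnt _ _ hw) he).2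
    have hb : bucketHit h m (w.length / m) k = true := (bucketHit_iff _ _ _).2 ⟨w, i, hdec, rfl, hi'⟩
    have : k' = k := by
      rcases lt_trichotomy k' k with hlt | heq | hlt
      · exact absurd hkk (hitCount_lt m e2 hlt).ne
      · exact heq
      · exact absurd hkk (hitCount_lt m hb hlt).ne'
    subst this
    rw [hdec] at e3
    simp only [Option.some.injEq, Prod.mk.injEq] at e3
    exact e3.1.symm)
  obtain ⟨p, hp1, hp2⟩ := hc _ _ hmem
  refine ⟨p, hp1, ?_⟩
  simp only [mkProg_length] at hp2
  exact hp2

theorem pref_length (X : Cantor) (n : ℕ) : (pref X n).length = n := by simp [pref]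

theorem lemB {U : List Bool →. List Bool} (hU : UniversalPF U) {s : ℝ} (hs : 0 ≤ s) {d : List Bool → ℝ}
    (hl : LowerSemicomputable d) (hd : IsSGale s d) (X : Cantor) (hX : ∀ᶠ n in atTop, 1 < d (pref X n))
    {ε : ℝ} (hε : 0 < ε) :
    ∀ᶠ n : ℕ in atTop, ∃ p, pref X n ∈ U p ∧ (p.length : ℝ) ≤ (s + ε) * n := by
  obtain ⟨g, hg, hmono, hlim⟩ := hl
  obtain ⟨m, hm⟩ := exists_nat_gt (4 / ε)
  have hm0 : 0 < m := by
    have : (0:ℝ) < m := lt_trans (by positivity) hm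
    exact_mod_cast this
  have hmR : (0:ℝ) < m := by exact_mod_cast hm0
  have hmε : 4 < m * ε := by rwa [div_lt_iff₀ hε] at hm
  let h : List Bool → ℕ → Bool := fun w i => decide (1 < g w i)
  have hh : Computable₂ h := computable_one_lt.comp hg
  have hm' : ∀ w, ∀ i j, i ≤ j → h w i = true → h w j = true := by
    intro w i j hij hi
    simp only [h, decide_eq_true_eq] at hi ⊢
    have : (g w i : ℝ) ≤ g w j := hmono w hij
    exact hi.trans_le (by exact_mod_cast this)
  have hhd : ∀ w, (∃ i, h w i = true) ↔ 1 < d w := by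
    intro w
    simp only [h, decide_eq_true_eq]
    constructor
    · rintro ⟨i, hi⟩
      have h1 : (g w i : ℝ) ≤ d w := (hmono w).ge_of_tendsto (hlim w) i
      have h2 : (1:ℝ) < g w i := by exact_mod_cast hi
      exact h2.trans_le h1
    · intro hw
      obtain ⟨i, hi⟩ := ((hlim w).eventually (lt_mem_nhds hw)).exists
      exact ⟨i, by exact_mod_cast hi⟩
  let a : ℕ := ⌊s * m⌋₊ + 2
  have ha1 : s * m + 1 ≤ a := by
    have := Nat.lt_floor_add_one (s * m)
    simp only [a]; push_cast; linarith
  have ha2 : (a:ℝ) ≤ s * m + 2 := by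
    have := Nat.floor_le (show 0 ≤ s * m by positivity)
    simp only [a]; push_cast; linarith
  obtain ⟨q0, hq0⟩ := exists_nat_gt (m * ((2:ℝ) ^ (s * m) * d []))
  have hB : ∀ q, q0 ≤ q → ∀ S : Finset (List Bool),
      (∀ w ∈ S, w.length / m = q ∧ ∃ i, h w i = true) → S.card < 2 ^ (a * q) := by
    intro q hq S hS
    have h1 := card_bucket hs hd m q hm0 S (fun w hw => ⟨(hS w hw).1, (hhd w).1 (hS w hw).2⟩)
    have h2 : (m:ℝ) * ((2:ℝ) ^ (s * (m * (q+1))) * d []) = (m * ((2:ℝ) ^ (s * m) * d [])) * (2:ℝ) ^ (s * m * q) := by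
      have : s * (m * ((q:ℝ)+1)) = s * m + s * m * q := by ring
      rw [this, Real.rpow_add (by norm_num)]; ring
    have h3 : (m * ((2:ℝ) ^ (s * m) * d [])) < (2:ℝ) ^ (q:ℝ) := by
      rw [Real.rpow_natCast]
      have h4 : (q:ℝ) < 2 ^ q := by exact_mod_cast Nat.lt_two_pow_self
      have h5 : (q0:ℝ) ≤ q := by exact_mod_cast hq
      linarith
    have h6 : (S.card : ℝ) < (2:ℝ) ^ ((a * q : ℕ) : ℝ) := by
      calc (S.card : ℝ) ≤ (m * ((2:ℝ) ^ (s * m) * d [])) * (2:ℝ) ^ (s * m * q) := by rw [← h2]; exact h1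
        _ < (2:ℝ) ^ (q:ℝ) * (2:ℝ) ^ (s * m * q) := by
            refine mul_lt_mul_of_pos_right h3 (by positivity)
        _ = (2:ℝ) ^ ((s * m + 1) * q) := by rw [← Real.rpow_add (by norm_num)]; ring_nf
        _ ≤ _ := by
            refine Real.rpow_le_rpow_of_exponent_le (by norm_num) ?_
            push_cast
            exact mul_le_mul_of_nonneg_right ha1 (by positivity)
    rw [Real.rpow_natCast] at h6
    exact_mod_cast h6
  obtain ⟨c, hc⟩ := lemB0 hU hh hm' m a q0 hB
  obtain ⟨N, hN⟩ := exists_nat_gt ((m:ℝ) * (1 + c))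
  filter_upwards [hX, eventually_ge_atTop (m * q0), eventually_ge_atTop N] with n hn1 hn2 hn3
  obtain ⟨p, hp1, hp2⟩ := hc (pref X n)
    (by rw [pref_length, Nat.le_div_iff_mul_le hm0]; linarith) ((hhd _).2 hn1)
  refine ⟨p, hp1, ?_⟩
  rw [pref_length] at hp2
  have hq : ((n / m : ℕ) : ℝ) * m ≤ n := by exact_mod_cast Nat.div_mul_le_self n m
  have hp3 : (p.length : ℝ) ≤ ((n / m : ℕ) : ℝ) + 1 + a * ((n / m : ℕ) : ℝ) + c := by exact_mod_cast hp2
  have hn4 : (m:ℝ) * (1 + c) < n := hN.trans_le (by exact_mod_cast hn3)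
  generalize ((n / m : ℕ) : ℝ) = q at *
  have hq0' : (0:ℝ) ≤ n := by positivity
  -- multiply by m
  have : (p.length : ℝ) * m ≤ ((s + ε) * n) * m := by
    have e1 : (p.length : ℝ) * m ≤ (q + 1 + a * q + c) * m := mul_le_mul_of_nonneg_right hp3 hmR.le
    have e2 : (1 + (a:ℝ)) * (q * m) ≤ (1 + a) * n := mul_le_mul_of_nonneg_left hq (by positivity)
    have e3 : (1 + (a:ℝ)) * n ≤ (s * m + 3) * n := mul_le_mul_of_nonneg_right (by linarith) hq0'
    have e4 : (4:ℝ) * n ≤ (m * ε) * n := mul_le_mul_of_nonneg_right hmε.le hq0'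
    nlinarith
  exact le_of_mul_le_mul_right this hmR

/-! ### The gale of a prefix-free machine -/

open Nat.Partrec (Code) in
theorem exists_res {U : List Bool →. List Bool} (hU : Partrec U) :
    ∃ res : ℕ → ℕ → Option (List Bool × List Bool), Computable₂ res ∧
      (∀ i k p v, res i k = some (p, v) → Encodable.encode p = k ∧ v ∈ U p ∧ k < i) ∧
      (∀ i j k y, i ≤ j → res i k = some y → res j k = some y) ∧
      (∀ p v, v ∈ U p → ∃ i, res i (Encodable.encode p) = some (p, v)) := by
  obtain ⟨c, hc⟩ := Code.exists_code.1 hU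
  have hev : ∀ p x, x ∈ c.eval (Encodable.encode p) ↔ ∃ v, v ∈ U p ∧ Encodable.encode v = x := by
    intro p x
    rw [hc]
    simp
  refine ⟨fun i k => (Encodable.decode₂ (List Bool) k).bind fun p =>
    (Code.evaln i c k).bind fun x => (Encodable.decode (α := List Bool) x).map fun v => (p, v), ?_, ?_, ?_, ?_⟩
  · refine Primrec.to_comp ?_
    have hdec : Primrec (Encodable.decode₂ (List Bool)) := by
      refine Primrec.option_bind Primrec.decode ?_
      exact Primrec.option_guard (p := fun (x : ℕ × (List Bool)) y => Encodable.encode y = x.1)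
        (Primrec.eq.comp (Primrec.encode.comp Primrec.snd) (Primrec.fst.comp Primrec.fst)) Primrec.snd
    refine Primrec.option_bind (hdec.comp Primrec.snd) ?_
    refine Primrec.option_bind ?_ ?_
    · exact Code.primrec_evaln.comp (Primrec.pair (Primrec.pair (Primrec.fst.comp Primrec.fst)
        (Primrec.const c)) (Primrec.snd.comp Primrec.fst))
    · refine Primrec.option_map (Primrec.decode.comp Primrec.snd) ?_
      exact Primrec.pair (Primrec.snd.comp (Primrec.fst.comp Primrec.fst)) Primrec.snd
  · intro i k p v hy
    simp only [Option.bind_eq_some_iff, Option.map_eq_some_iff, Prod.mk.injEq] at hy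
    obtain ⟨p', h1, x, h2, v', h3, rfl, rfl⟩ := hy
    have hk := Encodable.decode₂_eq_some.1 h1
    refine ⟨hk, ?_, Code.evaln_bound h2⟩
    have h4 : x ∈ c.eval (Encodable.encode p') := by rw [hk]; exact Code.evaln_sound h2
    obtain ⟨v, hv, rfl⟩ := (hev _ _).1 h4
    rw [Encodable.encodek] at h3
    simp only [Option.some.injEq] at h3
    exact h3 ▸ hv
  · intro i j k y hij hy
    simp only [Option.bind_eq_some_iff] at hy ⊢
    obtain ⟨p', h1, x, h2, h3⟩ := hy
    exact ⟨p', h1, x, Code.evaln_mono hij h2, h3⟩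
  · intro p v hv
    obtain ⟨i, hi⟩ := Code.evaln_complete.1 ((hev p _).2 ⟨v, hv, rfl⟩)
    refine ⟨i, ?_⟩
    simp only [Option.bind_eq_some_iff]
    exact ⟨p, Encodable.encodek₂ _, _, hi, by simp⟩

theorem pref_succ (Y : Cantor) (n : ℕ) : pref Y (n+1) = pref Y n ++ [Y n] := by
  simp [pref, List.range_succ]

def padSeq (v : List Bool) : Cantor := fun j => v.getD j false

theorem pref_padSeq (v : List Bool) : pref (padSeq v) v.length = v := by
  refine List.ext_getElem (by simp [pref]) ?_
  intro i h1 h2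
  simp [pref, padSeq, h2]

section Gale

variable (res : ℕ → ℕ → Option (List Bool × List Bool))

def wt (w : List Bool) (i k : ℕ) : ℕ :=
  ((res i k).map fun y => if pref (padSeq y.2) w.length = w then 2 ^ (i - y.1.length) else 0).getD 0

def numW (w : List Bool) (i : ℕ) : ℕ :=
  Nat.rec (motive := fun _ => ℕ) 0 (fun k c => c + wt res w i k) i

def galeApprox (A B : ℕ) (w : List Bool) (i : ℕ) : ℚ :=
  ((A ^ w.length * numW res w i : ℕ) : ℚ) / ((((B+1) ^ w.length * 2 ^ i - 1 : ℕ) : ℚ) + 1)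

variable {res}

theorem numW_eq (w : List Bool) (i : ℕ) : numW res w i = ∑ k ∈ Finset.range i, wt res w i k := by
  have : ∀ j, Nat.rec (motive := fun _ => ℕ) 0 (fun k c => c + wt res w i k) j
      = ∑ k ∈ Finset.range j, wt res w i k := by
    intro j
    induction j with
    | zero => rfl
    | succ j ih => rw [Finset.sum_range_succ, ← ih]
  exact this i

theorem computable_galeApprox (hres : Computable₂ res) (A B : ℕ) : Computable₂ (galeApprox res A B) := by
  have hlen : Computable fun x : List Bool × ℕ => x.1.length := Computable.list_length.comp Computable.fst
  have hpow : Computable₂ fun x y : ℕ => x ^ y := primrec_pow.to_comp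
  refine computable_mkQ.comp (g := fun x : List Bool × ℕ => A ^ x.1.length * numW res x.1 x.2)
    (h := fun x : List Bool × ℕ => (B+1) ^ x.1.length * 2 ^ x.2 - 1) ?_ ?_
  · refine Primrec.nat_mul.to_comp.comp (hpow.comp (Computable.const A) hlen) ?_
    refine Computable.nat_rec (f := fun x : List Bool × ℕ => x.2) (g := fun _ => 0)
      (h := fun x (y : ℕ × ℕ) => y.2 + wt res x.1 x.2 y.1)
      Computable.snd (Computable.const 0) ?_
    refine Primrec.nat_add.to_comp.comp (Computable.snd.comp Computable.snd) ?_
    refine Computable.option_getD (Computable.option_map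
      (hres.comp (Computable.snd.comp Computable.fst) (Computable.fst.comp Computable.snd)) ?_)
      (Computable.const 0)
    refine Primrec.to_comp ?_
    have hw : Primrec fun x : (((List Bool × ℕ) × (ℕ × ℕ)) × (List Bool × List Bool)) => x.1.1.1 :=
      Primrec.fst.comp (Primrec.fst.comp Primrec.fst)
    have hi : Primrec fun x : (((List Bool × ℕ) × (ℕ × ℕ)) × (List Bool × List Bool)) => x.1.1.2 :=
      Primrec.snd.comp (Primrec.fst.comp Primrec.fst)
    refine Primrec.ite ?_ ?_ (Primrec.const 0)
    · refine Primrec.eq.comp ?_ hw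
      refine Primrec.list_map (Primrec.list_range.comp (Primrec.list_length.comp hw)) ?_
      exact (Primrec.list_getD false).comp (Primrec.snd.comp (Primrec.snd.comp Primrec.fst)) Primrec.snd
    · exact primrec_pow.comp (Primrec.const 2) (Primrec.nat_sub.comp hi
        (Primrec.list_length.comp (Primrec.fst.comp Primrec.snd)))
  · refine Primrec.nat_sub.to_comp.comp (Primrec.nat_mul.to_comp.comp ?_ ?_) (Computable.const 1)
    · exact hpow.comp (Computable.const _) hlen
    · exact hpow.comp (Computable.const _) Computable.snd

theorem wt_split (w : List Bool) (i k : ℕ) :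
    wt res w i k = wt res (w ++ [false]) i k + wt res (w ++ [true]) i k := by
  unfold wt
  cases res i k with
  | none => simp
  | some y =>
    simp only [Option.map_some, Option.getD_some, List.length_append, List.length_singleton, pref_succ]
    by_cases hw : pref (padSeq y.2) w.length = w
    · rw [hw]
      cases padSeq y.2 w.length <;> simp
    · have : ∀ b b', pref (padSeq y.2) w.length ++ [b] ≠ w ++ [b'] := by
        intro b b' h
        exact hw (List.append_inj_left' h rfl)
      simp [hw, this]

theorem numW_split (w : List Bool) (i : ℕ) :
    numW res w i = numW res (w ++ [false]) i + numW res (w ++ [true]) i := by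
  simp only [numW_eq, ← Finset.sum_add_distrib]
  exact Finset.sum_congr rfl fun k _ => wt_split w i k

variable {U : List Bool →. List Bool}

theorem numW_mono
    (h1 : ∀ i k p v, res i k = some (p, v) → Encodable.encode p = k ∧ v ∈ U p ∧ k < i)
    (h2 : ∀ i j k y, i ≤ j → res i k = some y → res j k = some y)
    (w : List Bool) (i : ℕ) : 2 * numW res w i ≤ numW res w (i+1) := by
  rw [numW_eq, numW_eq, Finset.mul_sum, Finset.sum_range_succ]
  refine le_trans (Finset.sum_le_sum fun k _ => ?_) (Nat.le_add_right _ _)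
  unfold wt
  cases hr : res i k with
  | none => simp
  | some y =>
    obtain ⟨p, v⟩ := y
    rw [h2 i (i+1) k _ (Nat.le_succ i) hr]
    simp only [Option.map_some, Option.getD_some]
    split_ifs
    · obtain ⟨e1, -, e2⟩ := h1 _ _ _ _ hr
      have := Encodable.length_le_encode p
      rw [show i + 1 - p.length = (i - p.length) + 1 by omega, pow_succ, mul_comm]
    · simp

theorem numW_le
    (h1 : ∀ i k p v, res i k = some (p, v) → Encodable.encode p = k ∧ v ∈ U p ∧ k < i)
    (hpf : ∀ p q : List Bool, (U p).Dom → (U q).Dom → p <+: q → p = q)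
    (w : List Bool) (i : ℕ) : numW res w i ≤ 2 ^ i := by
  classical
  rw [numW_eq]
  let f : ℕ → List Bool := fun k => ((res i k).getD ([], [])).1
  let F := (Finset.range i).filter fun k => (res i k).isSome = true
  have hF : ∀ k ∈ F, ∃ v, res i k = some (f k, v) := by
    intro k hk
    obtain ⟨⟨p, v⟩, hy⟩ := Option.isSome_iff_exists.1 (Finset.mem_filter.1 hk).2
    exact ⟨v, by simp [f, hy]⟩
  have e1 : ∑ k ∈ Finset.range i, wt res w i k ≤ ∑ k ∈ F, 2 ^ (i - (f k).length) := by
    rw [Finset.sum_filter]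
    refine Finset.sum_le_sum fun k _ => ?_
    unfold wt
    cases hr : res i k with
    | none => simp
    | some y =>
      simp only [Option.map_some, Option.getD_some, Option.isSome_some, if_true, f, hr]
      split_ifs <;> simp
  have hinj : Set.InjOn f F := by
    intro x hx y hy hxy
    obtain ⟨v, hv⟩ := hF x hx
    obtain ⟨v', hv'⟩ := hF y hy
    rw [← (h1 _ _ _ _ hv).1, ← (h1 _ _ _ _ hv').1, hxy]
  have e2 : ∑ k ∈ F, 2 ^ (i - (f k).length) = ∑ p ∈ F.image f, 2 ^ (i - p.length) := by
    rw [Finset.sum_image hinj]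
  refine e1.trans (e2.le.trans (kraft_finite _ ?_ _ ?_))
  · intro p hp q hq
    obtain ⟨k, hk, rfl⟩ := Finset.mem_image.1 hp
    obtain ⟨k', hk', rfl⟩ := Finset.mem_image.1 hq
    obtain ⟨v, hv⟩ := hF k hk
    obtain ⟨v', hv'⟩ := hF k' hk'
    exact hpf _ _ (Part.dom_iff_mem.2 ⟨_, (h1 _ _ _ _ hv).2.1⟩) (Part.dom_iff_mem.2 ⟨_, (h1 _ _ _ _ hv').2.1⟩)
  · intro p hp
    obtain ⟨k, hk, rfl⟩ := Finset.mem_image.1 hp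
    obtain ⟨v, hv⟩ := hF k hk
    obtain ⟨e1, -, e2⟩ := h1 _ _ _ _ hv
    have := Encodable.length_le_encode (f k)
    omega

theorem le_numW
    (h1 : ∀ i k p v, res i k = some (p, v) → Encodable.encode p = k ∧ v ∈ U p ∧ k < i)
    {i : ℕ} {p v : List Bool} (hr : res i (Encodable.encode p) = some (p, v)) :
    2 ^ (i - p.length) ≤ numW res v i := by
  rw [numW_eq]
  have hk := (h1 _ _ _ _ hr).2.2
  refine le_trans ?_ (Finset.single_le_sum (f := fun k => wt res v i k) (fun _ _ => Nat.zero_le _) (Finset.mem_range.2 hk))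
  simp [wt, hr, pref_padSeq]

theorem galeApprox_cast (A B : ℕ) (w : List Bool) (i : ℕ) :
    (galeApprox res A B w i : ℝ) = ((A:ℝ) / (B+1)) ^ w.length * ((numW res w i : ℝ) / 2 ^ i) := by
  unfold galeApprox
  have : 1 ≤ (B+1) ^ w.length * 2 ^ i := Nat.one_le_iff_ne_zero.2 (by positivity)
  push_cast [Nat.cast_sub this]
  rw [div_pow, div_mul_div_comm]
  congr 1
  ring

end Gale

theorem lemA {U : List Bool →. List Bool} (hU : PFMachine U) (A B : ℕ) (hA : 0 < A) :
    ∃ d : List Bool → ℝ, LowerSemicomputable d ∧ IsSGale (Real.logb 2 ((A:ℝ) / (B+1))) d ∧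
      ∀ v p, v ∈ U p → ((A:ℝ) / (B+1)) ^ v.length * ((2:ℝ) ^ p.length)⁻¹ ≤ d v := by
  obtain ⟨res, hres, h1, h2, h3⟩ := exists_res hU.1
  set r : ℝ := (A:ℝ) / (B+1) with hr
  have hr0 : 0 < r := by positivity
  have hmono : ∀ w, Monotone fun i => (galeApprox res A B w i : ℝ) := by
    intro w
    refine monotone_nat_of_le_succ fun i => ?_
    rw [galeApprox_cast, galeApprox_cast]
    refine mul_le_mul_of_nonneg_left ?_ (by positivity)
    rw [div_le_div_iff₀ (by positivity) (by positivity), pow_succ]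
    have : (2:ℝ) * numW res w i ≤ numW res w (i+1) := by exact_mod_cast numW_mono h1 h2 w i
    have h0 : (0:ℝ) < 2 ^ i := by positivity
    nlinarith
  have hbdd : ∀ w, BddAbove (Set.range fun i => (galeApprox res A B w i : ℝ)) := by
    intro w
    refine ⟨r ^ w.length, ?_⟩
    rintro _ ⟨i, rfl⟩
    simp only
    rw [galeApprox_cast]
    have : (numW res w i : ℝ) ≤ 2 ^ i := by exact_mod_cast numW_le h1 hU.2 w i
    have h4 : (numW res w i : ℝ) / 2 ^ i ≤ 1 := by rwa [div_le_one (by positivity)]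
    calc _ ≤ r ^ w.length * 1 := mul_le_mul_of_nonneg_left h4 (by positivity)
      _ = _ := mul_one _
  have hlim := fun w => tendsto_atTop_ciSup (hmono w) (hbdd w)
  refine ⟨fun w => ⨆ i, (galeApprox res A B w i : ℝ),
    ⟨galeApprox res A B, computable_galeApprox hres A B, hmono, hlim⟩, ⟨?_, ?_⟩, ?_⟩
  · intro w
    refine ge_of_tendsto' (hlim w) fun i => ?_
    rw [galeApprox_cast]; positivity
  · intro w
    rw [Real.rpow_logb (by norm_num) (by norm_num) hr0]
    refine tendsto_nhds_unique ((hlim w).const_mul r) ?_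
    refine ((hlim (w ++ [false])).add (hlim (w ++ [true]))).congr fun i => ?_
    rw [galeApprox_cast, galeApprox_cast, galeApprox_cast, numW_split w i]
    simp only [List.length_append, List.length_singleton]
    push_cast
    ring
  · intro v p hv
    obtain ⟨i, hi⟩ := h3 p v hv
    refine le_trans ?_ (le_ciSup (hbdd v) i)
    rw [galeApprox_cast]
    refine mul_le_mul_of_nonneg_left ?_ (by positivity)
    have h4 : ((2 ^ (i - p.length) : ℕ) : ℝ) ≤ numW res v i := by exact_mod_cast le_numW h1 hi
    obtain ⟨-, -, e2⟩ := h1 _ _ _ _ hi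
    have hle : p.length ≤ i := (Encodable.length_le_encode p).trans e2.le
    rw [le_div_iff₀ (by positivity)]
    refine le_trans (le_of_eq ?_) h4
    push_cast
    rw [inv_mul_eq_div, eq_comm, eq_div_iff (by positivity), ← pow_add]
    congr 1; omega

/-! ### The main theorem -/

theorem K_le {U : List Bool →. List Bool} {w p : List Bool} (h : w ∈ U p) : K U w ≤ p.length :=
  Nat.sInf_le ⟨p, h, rfl⟩

theorem exists_K {U : List Bool →. List Bool} {w p : List Bool} (h : w ∈ U p) :
    ∃ q, w ∈ U q ∧ q.length = K U w :=
  Nat.sInf_mem (s := {n : ℕ | ∃ p : List Bool, w ∈ U p ∧ p.length = n}) ⟨p.length, p, h, rfl⟩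

theorem K_bound {U : List Bool →. List Bool} (hU : UniversalPF U) (X : Cantor) :
    ∀ᶠ n : ℕ in atTop, ∃ p, pref X n ∈ U p ∧ (p.length : ℝ) ≤ (1 + 1) * n := by
  refine lemB hU (s := 1) (d := fun _ => 2) (by norm_num) ?_ ?_ X ?_ one_pos
  · refine ⟨fun _ _ => 2, Computable.const 2, fun _ => monotone_const, fun _ => ?_⟩
    simp
  · refine ⟨fun _ => by norm_num, fun _ => by norm_num⟩
  · exact Filter.Eventually.of_forall fun _ => by norm_num

theorem DimK_le {U : List Bool →. List Bool} {X : Cantor} {t : ℝ}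
    (h : ∀ᶠ n : ℕ in atTop, ∃ p, pref X n ∈ U p ∧ (p.length : ℝ) ≤ t * n) : 
    ∀ᶠ n : ℕ in atTop, (K U (pref X n) : ℝ) / n ≤ t := by
  filter_upwards [h, eventually_gt_atTop 0] with n ⟨p, hp1, hp2⟩ hn
  have hn' : (0:ℝ) < n := by exact_mod_cast hn
  rw [div_le_iff₀ hn']
  refine le_trans ?_ hp2
  exact_mod_cast K_le hp1

/-- The constructive strong dimension of any sequence `X` equals
`limsup_n K(X↾n)/n`, for prefix-free Kolmogorov complexity `K` with respect to
any universal prefix-free machine. -/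
theorem cDim_eq_limsup_K (U : List Bool →. List Bool) (hU : UniversalPF U)
    (X : Cantor) : cDim {X} = DimK U X := by
  have hnn : ∀ n : ℕ, 0 ≤ (K U (pref X n) : ℝ) / n := fun n => by positivity
  have hcob : IsCoboundedUnder (· ≤ ·) atTop (fun n : ℕ => (K U (pref X n) : ℝ) / n) :=
    IsBoundedUnder.isCoboundedUnder_le (isBoundedUnder_of ⟨0, hnn⟩)
  have hbd : IsBoundedUnder (· ≤ ·) atTop (fun n : ℕ => (K U (pref X n) : ℝ) / n) :=
    ⟨_, Filter.eventually_map.2 (DimK_le (K_bound hU X))⟩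
  have hD0 : 0 ≤ DimK U X := by
    refine le_limsup_of_le hbd fun b hb => ?_
    obtain ⟨n, hn⟩ := hb.exists
    exact (hnn n).trans hn
  -- upper bound
  have hup : ∀ t, DimK U X < t → ∃ s ∈ {s : ℝ | 0 ≤ s ∧ ∃ d : List Bool → ℝ,
      LowerSemicomputable d ∧ IsSGale s d ∧ ∀ Y ∈ ({X} : Set Cantor), StronglySucceedsOn d Y}, s ≤ t := by
    intro t ht
    obtain ⟨s', hs1, hs2⟩ := exists_between ht
    have hlt : (2:ℝ) ^ s' < 2 ^ t := Real.rpow_lt_rpow_of_exponent_lt (by norm_num) hs2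
    obtain ⟨ρ, hρ1, hρ2⟩ := exists_rat_btwn hlt
    have hs0 : 0 < (2:ℝ) ^ s' := by positivity
    have hρ0 : (0:ℝ) < ρ := hs0.trans hρ1
    have hρ0' : 0 < ρ := by exact_mod_cast hρ0
    obtain ⟨A, hAe⟩ := Int.eq_ofNat_of_zero_le (Rat.num_pos.2 hρ0').le
    have hA : 0 < A := by
      have := Rat.num_pos.2 hρ0'
      rw [hAe] at this; exact_mod_cast this
    have hden : ((ρ.den - 1 : ℕ) : ℝ) + 1 = ρ.den := by
      rw [Nat.cast_sub ρ.den_pos]; simp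
    have hr : (A:ℝ) / (((ρ.den - 1 : ℕ) : ℝ) + 1) = ρ := by
      rw [hden, Rat.cast_def, hAe]; simp
    obtain ⟨d, hd1, hd2, hd3⟩ := lemA hU.1 A (ρ.den - 1) hA
    rw [hr] at hd2 hd3
    have hls : s' < Real.logb 2 ρ := (Real.lt_logb_iff_rpow_lt (by norm_num) hρ0).2 hρ1
    refine ⟨Real.logb 2 ρ, ⟨(hD0.trans hs1.le).trans hls.le, d, hd1, hd2, ?_⟩,
      ((Real.logb_lt_iff_lt_rpow (by norm_num) hρ0).2 hρ2).le⟩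
    intro Y hY
    rw [Set.mem_singleton_iff] at hY
    subst hY
    intro C
    have hev : ∀ᶠ n : ℕ in atTop, (K U (pref Y n) : ℝ) / n < s' := eventually_lt_of_limsup_lt hs1 hbd
    have hq1 : 1 < (ρ:ℝ) / 2 ^ s' := by rwa [one_lt_div hs0]
    have hC : ∀ᶠ n : ℕ in atTop, C < ((ρ:ℝ) / 2 ^ s') ^ n :=
      (tendsto_pow_atTop_atTop_of_one_lt hq1).eventually_gt_atTop C
    obtain ⟨N, hN⟩ := eventually_atTop.1 ((hev.and hC).and ((K_bound hU Y).and (eventually_gt_atTop 0)))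
    refine ⟨N, fun n hn => ?_⟩
    obtain ⟨⟨e1, e2⟩, ⟨p, e3, -⟩, e4⟩ := hN n hn
    obtain ⟨q, hq, hqK⟩ := exists_K e3
    refine e2.trans_le (le_trans ?_ (hd3 _ _ hq))
    rw [pref_length, div_pow, div_eq_mul_inv]
    refine mul_le_mul_of_nonneg_left ?_ (by positivity)
    refine inv_anti₀ (by positivity) ?_
    rw [hqK, ← Real.rpow_natCast, ← Real.rpow_natCast, ← Real.rpow_mul (by norm_num)]
    refine Real.rpow_le_rpow_of_exponent_le (by norm_num) ?_
    have hn' : (0:ℝ) < n := by exact_mod_cast e4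
    exact ((div_lt_iff₀ hn').1 e1).le
  have hbb : BddBelow {s : ℝ | 0 ≤ s ∧ ∃ d : List Bool → ℝ,
      LowerSemicomputable d ∧ IsSGale s d ∧ ∀ Y ∈ ({X} : Set Cantor), StronglySucceedsOn d Y} :=
    ⟨0, fun s hs => hs.1⟩
  refine le_antisymm ?_ ?_
  · refine le_of_forall_gt_imp_ge_of_dense fun t ht => ?_
    obtain ⟨s, hs, hst⟩ := hup t ht
    exact (csInf_le hbb hs).trans hst
  · refine le_csInf ?_ ?_
    · obtain ⟨s, hs, -⟩ := hup (DimK U X + 1) (by linarith)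
      exact ⟨s, hs⟩
    · rintro s ⟨hs0, d, hl, hd, hX⟩
      refine le_of_forall_pos_le_add fun ε hε => ?_
      refine limsup_le_of_le hcob ?_
      refine DimK_le (lemB hU hs0 hl hd X ?_ hε)
      obtain ⟨N, hN⟩ := hX X rfl 1
      exact eventually_atTop.2 ⟨N, hN⟩
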